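/- Let V be an n-vertex set with a partition V = V₁ ∪ ⋯ ∪ V_k, let 0 < q < p ≤ 3/4, and set s̄ := 2^13·√(p(1−q)·n)·log n/(p−q). Let S and W be fixed disjoint subsets of V, and let the edges between S and W be present independently: with probability p if both endpoints lie in the same cluster and with probability q otherwise. Suppose s′ is a number with s′ ≥ 0.48·s̄, and suppose that for some index i: |S ∩ V_i| ≥ s′/21 and |S ∩ V_j| ≤ s′/210 for every j ≠ i. Then with probability 1 − O(n^{−3}), the set {v ∈ W : N_S(v) ≥ q·|S| + (p−q)·s′/56} is exactly V_i ∩ W. -/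

import Mathlib

open MeasureTheory

noncomputable def bern (p : ℝ) : Measure Bool :=
  ENNReal.ofReal p • Measure.dirac true + ENNReal.ofReal (1 - p) • Measure.dirac false

noncomputable def sbm (n k : ℕ) (c : Fin n → Fin k) (p q : ℝ) :
    Measure ({e : Fin n × Fin n // e.1 < e.2} → Bool) :=
  Measure.pi fun e => bern (if c e.1.1 = c e.1.2 then p else q)

def clusterF {n k : ℕ} (c : Fin n → Fin k) (i : Fin k) : Finset (Fin n) :=
  Finset.univ.filter fun v => c v = i

def adjB {n : ℕ} (G : {e : Fin n × Fin n // e.1 < e.2} → Bool) (u v : Fin n) : Bool :=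
  if h : u < v then G ⟨(u, v), h⟩ else if h' : v < u then G ⟨(v, u), h'⟩ else false

/-- `N_S(v)`: the number of neighbors of `v` in `S` (not counting `v` itself). -/
def nbr {n : ℕ} (G : {e : Fin n × Fin n // e.1 < e.2} → Bool) (S : Finset (Fin n)) (v : Fin n) :
    ℕ :=
  (S.filter fun u => adjB G u v = true).card

/-- `s̄ := 2^13·√(p(1−q)·n)·log n/(p−q)`. -/
noncomputable def sbar (n : ℕ) (p q : ℝ) : ℝ :=
  2 ^ 13 * Real.sqrt (p * (1 - q) * n) * Real.log n / (p - q)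

theorem isProbabilityMeasure_bern {m : ℝ} (h0 : 0 ≤ m) (h1 : m ≤ 1) :
    IsProbabilityMeasure (bern m) := by
  constructor
  simp only [bern, Measure.coe_add, Measure.coe_smul, Pi.add_apply, Pi.smul_apply, smul_eq_mul,
    measure_univ, mul_one]
  rw [← ENNReal.ofReal_add h0 (by linarith)]
  simp

theorem integral_bern {m : ℝ} (h0 : 0 ≤ m) (h1 : m ≤ 1) (f : Bool → ℝ) :
    ∫ b, f b ∂bern m = m * f true + (1 - m) * f false := by
  rw [bern, integral_add_measure (.smul_measure .of_finite ENNReal.ofReal_ne_top)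
    (.smul_measure .of_finite ENNReal.ofReal_ne_top)]
  simp [integral_smul_measure, h0, h1]

theorem integral_exp_bern_le {m l : ℝ} (h0 : 0 ≤ m) (h1 : m ≤ 1) (hl : |l| ≤ 1) :
    ∫ b, Real.exp (l * ((if b = true then 1 else 0) - m)) ∂bern m ≤
      Real.exp (l ^ 2 * (m * (1 - m))) := by
  rw [integral_bern h0 h1]
  simp only [if_true, Bool.false_eq_true, if_false]
  have key : ∀ y : ℝ, |y| ≤ 1 → Real.exp (l * y) ≤ 1 + l * y + (l * y) ^ 2 := fun y hy => by
    have := (abs_le.1 (Real.abs_exp_sub_one_sub_id_le (x := l * y)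
      (by rw [abs_mul]; exact mul_le_one₀ hl (abs_nonneg _) hy))).2
    linarith
  have e1 := key (1 - m) (by rw [abs_le]; constructor <;> linarith)
  have e2 := key (0 - m) (by rw [abs_le]; constructor <;> linarith)
  have e3 := Real.add_one_le_exp (l ^ 2 * (m * (1 - m)))
  have e4 := mul_le_mul_of_nonneg_left e1 h0
  have e5 := mul_le_mul_of_nonneg_left e2 (sub_nonneg.2 h1)
  nlinarith

/-- Chernoff bound for a sum of independent Bernoulli variables; the sign of `l` selects the
tail. -/
theorem measureReal_pi_bern_le {ι : Type*} [Fintype ι] [DecidableEq ι] (m : ι → ℝ)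
    (h0 : ∀ e, 0 ≤ m e) (h1 : ∀ e, m e ≤ 1) (T : Finset ι) {l : ℝ} (hl : |l| ≤ 1) (t : ℝ) :
    (Measure.pi fun e => bern (m e)).real
        {G | t ≤ l * ∑ e ∈ T, ((if G e = true then 1 else 0) - m e)} ≤
      Real.exp (l ^ 2 * ∑ e ∈ T, m e * (1 - m e) - t) := by
  have : ∀ e, IsProbabilityMeasure (bern (m e)) :=
    fun e => isProbabilityMeasure_bern (h0 e) (h1 e)
  refine (ProbabilityTheory.measure_ge_le_exp_mul_mgf (t := 1) t zero_le_one .of_finite).trans ?_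
  rw [sub_eq_neg_add, Real.exp_add, neg_one_mul]
  refine mul_le_mul_of_nonneg_left ?_ (Real.exp_pos _).le
  let F : ι → Bool → ℝ := fun e b =>
    if e ∈ T then Real.exp (l * ((if b = true then 1 else 0) - m e)) else 1
  have hprod : ∀ G : ι → Bool,
      Real.exp (1 * (l * ∑ e ∈ T, ((if G e = true then (1 : ℝ) else 0) - m e))) =
        ∏ e, F e (G e) := fun G => by
    simp only [F]
    rw [one_mul, Finset.mul_sum, Real.exp_sum, Finset.prod_ite_mem, Finset.univ_inter]
  rw [ProbabilityTheory.mgf]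
  rw [integral_congr_ae (.of_forall hprod), integral_fintype_prod_eq_prod F,
    Finset.mul_sum, Real.exp_sum, ← Finset.univ_inter T, ← Finset.prod_ite_mem]
  refine Finset.prod_le_prod (fun e _ => integral_nonneg fun b => ?_) fun e _ => ?_
  · simp only [F, Pi.zero_apply]
    split_ifs <;> positivity
  · by_cases he : e ∈ T
    · simpa only [F, he, if_true] using integral_exp_bern_le (h0 e) (h1 e) hl
    · simp [F, he]

/-- The potential edges joining `v` to `S`. -/
def edgesTo {n : ℕ} (S : Finset (Fin n)) (v : Fin n) : Finset {e : Fin n × Fin n // e.1 < e.2} :=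
  Finset.univ.filter fun e => (e.1.1 = v ∧ e.1.2 ∈ S) ∨ (e.1.2 = v ∧ e.1.1 ∈ S)

theorem sum_edgesTo {n : ℕ} {S : Finset (Fin n)} {v : Fin n} (hv : v ∉ S)
    (f : {e : Fin n × Fin n // e.1 < e.2} → ℝ) (g : Fin n → ℝ)
    (hlt : ∀ u ∈ S, ∀ h : u < v, f ⟨(u, v), h⟩ = g u)
    (hgt : ∀ u ∈ S, ∀ h : v < u, f ⟨(v, u), h⟩ = g u) :
    ∑ e ∈ edgesTo S v, f e = ∑ u ∈ S, g u := by
  refine Finset.sum_bij (fun e _ => if e.1.1 = v then e.1.2 else e.1.1) ?_ ?_ ?_ ?_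
  · rintro ⟨⟨a, b⟩, hab⟩ he
    simp only [edgesTo, Finset.mem_filter, Finset.mem_univ, true_and] at he ⊢
    grind
  · rintro ⟨⟨a, b⟩, hab⟩ he ⟨⟨a', b'⟩, hab'⟩ he' h
    simp only [edgesTo, Finset.mem_filter, Finset.mem_univ, true_and] at he he' h
    simp only [Subtype.mk.injEq, Prod.mk.injEq]
    grind
  · intro u hu
    rcases lt_trichotomy u v with h | h | h
    · exact ⟨⟨(u, v), h⟩, by simp [edgesTo, hu], by simp [h.ne]⟩
    · exact absurd (h ▸ hu) hv
    · exact ⟨⟨(v, u), h⟩, by simp [edgesTo, hu], by simp⟩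
  · rintro ⟨⟨a, b⟩, hab⟩ he
    simp only [edgesTo, Finset.mem_filter, Finset.mem_univ, true_and] at he ⊢
    rcases he with ⟨rfl, hb⟩ | ⟨rfl, ha⟩
    · simpa using hgt b hb hab
    · have hab' : a < b := hab
      simpa [hab'.ne] using hlt a ha hab

theorem nbr_eq_sum_edgesTo {n : ℕ} (G : {e : Fin n × Fin n // e.1 < e.2} → Bool)
    {S : Finset (Fin n)} {v : Fin n} (hv : v ∉ S) :
    (nbr G S v : ℝ) = ∑ e ∈ edgesTo S v, if G e = true then 1 else 0 := by
  rw [sum_edgesTo hv _ fun u => if adjB G u v = true then (1 : ℝ) else 0]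
  · simp [nbr]
  · intro u _ h
    simp [adjB, h]
  · intro u _ h
    simp [adjB, h, h.not_gt]

theorem sum_edgesTo_prob {n k : ℕ} (c : Fin n → Fin k) (p q : ℝ) {S : Finset (Fin n)} {v : Fin n}
    (hv : v ∉ S) :
    ∑ e ∈ edgesTo S v, (if c e.1.1 = c e.1.2 then p else q) =
      q * S.card + (p - q) * (S ∩ clusterF c (c v)).card := by
  rw [sum_edgesTo hv _ fun u => if c u = c v then p else q]
  · have h : S ∩ clusterF c (c v) = S.filter fun u => c u = c v := by
      ext u
      simp [clusterF]
    have h' : ∀ u, (if c u = c v then p else q) = q + (p - q) * if c u = c v then 1 else 0 :=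
      fun u => by split_ifs <;> ring
    simp_rw [h', Finset.sum_add_distrib, ← Finset.mul_sum]
    simp [h, mul_comm]
  · simp
  · simp [eq_comm]

theorem sum_edgesTo_variance_le {n k : ℕ} (c : Fin n → Fin k) {p q : ℝ} (hq : 0 ≤ q) (hqp : q ≤ p)
    (hp : p ≤ 1) {S : Finset (Fin n)} {v : Fin n} (hv : v ∉ S) :
    ∑ e ∈ edgesTo S v, (if c e.1.1 = c e.1.2 then p else q) *
      (1 - if c e.1.1 = c e.1.2 then p else q) ≤ p * (1 - q) * n := by
  have hcard : ∑ _e ∈ edgesTo S v, (1 : ℝ) = S.card := by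
    rw [sum_edgesTo hv _ fun _ => (1 : ℝ)] <;> simp
  have hS : (S.card : ℝ) ≤ n := by exact_mod_cast (card_finset_fin_le S)
  calc _ ≤ ∑ _e ∈ edgesTo S v, p * (1 - q) * 1 := Finset.sum_le_sum fun e _ => by
        split_ifs <;> nlinarith
    _ ≤ p * (1 - q) * n := by
        rw [← Finset.mul_sum, hcard]
        exact mul_le_mul_of_nonneg_left hS (mul_nonneg (by linarith) (by linarith))

/-- Concentration of `N_S(v)` around its mean; `l = ±1` selects the tail. -/
theorem sbm_nbr_tail {n k : ℕ} (c : Fin n → Fin k) {p q : ℝ} (hq : 0 ≤ q) (hqp : q ≤ p)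
    (hp : p ≤ 1) {S : Finset (Fin n)} {v : Fin n} (hv : v ∉ S)
    (hx : 1 ≤ Real.sqrt (p * (1 - q) * n)) {l : ℝ} (hl : |l| = 1) (t : ℝ) :
    (sbm n k c p q).real {G | Real.sqrt (p * (1 - q) * n) * t ≤
        l * (nbr G S v - (q * S.card + (p - q) * (S ∩ clusterF c (c v)).card))} ≤
      Real.exp (1 - t) := by
  set x := Real.sqrt (p * (1 - q) * n) with hxdef
  have hx0 : 0 < x := by linarith
  have hxx : x ^ 2 = p * (1 - q) * n :=
    Real.sq_sqrt (mul_nonneg (mul_nonneg (by linarith) (by linarith)) (Nat.cast_nonneg n))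
  have h := measureReal_pi_bern_le
    (fun e : {e : Fin n × Fin n // e.1 < e.2} => if c e.1.1 = c e.1.2 then p else q)
    (fun e => by split_ifs <;> linarith) (fun e => by split_ifs <;> linarith)
    (edgesTo S v) (l := l / x) (by rw [abs_div, hl, abs_of_pos hx0]; exact (div_le_one hx0).2 hx) t
  have hset : {G : {e : Fin n × Fin n // e.1 < e.2} → Bool | x * t ≤
        l * (nbr G S v - (q * S.card + (p - q) * (S ∩ clusterF c (c v)).card))} =
      {G | t ≤ l / x * ∑ e ∈ edgesTo S v, ((if G e = true then (1 : ℝ) else 0) -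
        if c e.1.1 = c e.1.2 then p else q)} := by
    ext G
    simp only [Set.mem_ofPred_eq]
    rw [Finset.sum_sub_distrib, sum_edgesTo_prob c p q hv, ← nbr_eq_sum_edgesTo G hv,
      div_mul_eq_mul_div, le_div_iff₀ hx0, mul_comm x t]
  rw [hset]
  refine h.trans (Real.exp_le_exp.2 (sub_le_sub_right ?_ t))
  have hl2 : l ^ 2 = 1 := by rw [← sq_abs, hl, one_pow]
  rw [div_pow, hl2, div_mul_eq_mul_div, one_mul, div_le_one (by positivity), hxx]
  exact sum_edgesTo_variance_le c hq hqp hp hv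

/-- Let `S, W` be fixed disjoint subsets, `s′ ≥ 0.48·s̄`, and suppose for some
cluster `V_i`: `|S ∩ V_i| ≥ s′/21` and `|S ∩ V_j| ≤ s′/210` for every `j ≠ i`. Then with
probability `1 − O(n^{−3})`, the set `{v ∈ W : N_S(v) ≥ q|S| + (p−q)s′/56}` is exactly
`V_i ∩ W`. -/
theorem statement_11 :
    ∃ C : ℝ, 0 < C ∧
      ∀ (n k : ℕ) (c : Fin n → Fin k) (p q s' : ℝ), 0 < q → q < p → p ≤ 3 / 4 →
        ∀ S W : Finset (Fin n), Disjoint S W →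
          0.48 * sbar n p q ≤ s' →
          ∀ i : Fin k,
            s' / 21 ≤ ((S ∩ clusterF c i).card : ℝ) →
            (∀ j : Fin k, j ≠ i → ((S ∩ clusterF c j).card : ℝ) ≤ s' / 210) →
            ENNReal.ofReal (1 - C / (n : ℝ) ^ 3) ≤
              sbm n k c p q
                {G | {v : Fin n | v ∈ W ∧
                    q * (S.card : ℝ) + (p - q) * s' / 56 ≤ (nbr G S v : ℝ)} =
                  {v : Fin n | v ∈ clusterF c i ∧ v ∈ W}} := by
  refine ⟨3, by norm_num, fun n k c p q s' hq hqp hp S W hSW hs' i hi hj => ?_⟩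
  rcases Nat.lt_or_ge n 2 with hn | hn
  · interval_cases n
    · have hset : {G : {e : Fin 0 × Fin 0 // e.1 < e.2} → Bool | {v : Fin 0 | v ∈ W ∧
          q * (S.card : ℝ) + (p - q) * s' / 56 ≤ (nbr G S v : ℝ)} =
          {v : Fin 0 | v ∈ clusterF c i ∧ v ∈ W}} = Set.univ :=
        Set.eq_univ_of_forall fun G => Set.ext fun v => v.elim0
      rw [hset]
      simp [sbm]
    · rw [ENNReal.ofReal_of_nonpos (by norm_num)]
      exact zero_le
  have hn' : (2 : ℝ) ≤ n := by exact_mod_cast hn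
  have hn0 : (0 : ℝ) < n := by linarith
  set x := Real.sqrt (p * (1 - q) * n) with hx_def
  set L := Real.log n with hL_def
  have hpq : 0 < p - q := by linarith
  have hp1q : 0 < p * (1 - q) := mul_pos (by linarith) (by linarith)
  have hx0 : 0 < x := Real.sqrt_pos.2 (mul_pos hp1q hn0)
  have hxx : x ^ 2 = p * (1 - q) * n := Real.sq_sqrt (mul_pos hp1q hn0).le
  have hL : 0.69 ≤ L := by
    have := Real.log_le_log (by norm_num) hn'
    have := Real.log_two_gt_d9
    linarith
  have hxL : 0 < x * L := mul_pos hx0 (by linarith)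
  have hs : 3932 * (x * L) ≤ (p - q) * s' := by
    have h := mul_le_mul_of_nonneg_left hs' hpq.le
    have h' : (p - q) * (0.48 * sbar n p q) = 0.48 * 2 ^ 13 * (x * L) := by
      rw [sbar, ← hx_def, ← hL_def]
      field_simp
    rw [h'] at h
    linarith
  have hcard : ((S ∩ clusterF c i).card : ℝ) ≤ n := by
    exact_mod_cast (card_finset_fin_le _)
  have hx1 : 1 ≤ x := by
    have h1 : (p - q) * s' ≤ 21 * x ^ 2 := by
      rw [hxx]
      have : (p - q) * s' ≤ (p - q) * (21 * n) :=
        mul_le_mul_of_nonneg_left (by linarith) hpq.le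
      have : (p - q) * n ≤ p * (1 - q) * n :=
        mul_le_mul_of_nonneg_right (by nlinarith) hn0.le
      linarith
    have h2 : 100 * L ≤ x := le_of_mul_le_mul_left (by nlinarith) hx0
    linarith
  let μ := sbm n k c p q
  have : IsProbabilityMeasure μ := by
    have : ∀ e : {e : Fin n × Fin n // e.1 < e.2},
        IsProbabilityMeasure (bern (if c e.1.1 = c e.1.2 then p else q)) := fun e =>
      isProbabilityMeasure_bern (by split_ifs <;> linarith) (by split_ifs <;> linarith)
    exact inferInstanceAs (IsProbabilityMeasure (Measure.pi _))
  let B : Fin n → Set ({e : Fin n × Fin n // e.1 < e.2} → Bool) := fun v =>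
    {G | v ∈ W ∧ ¬(q * (S.card : ℝ) + (p - q) * s' / 56 ≤ (nbr G S v : ℝ) ↔ c v = i)}
  have hB : ∀ v, μ.real (B v) ≤ 3 / (n : ℝ) ^ 4 := by
    intro v
    have hexp : Real.exp (1 - 4 * L) ≤ 3 / (n : ℝ) ^ 4 := by
      rw [Real.exp_sub, show (4 : ℝ) * L = (4 : ℕ) * L by norm_num, Real.exp_nat_mul,
        Real.exp_log hn0]
      exact div_le_div_of_nonneg_right (by linarith [Real.exp_one_lt_d9]) (by positivity)
    by_cases hvW : v ∈ W
    swap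
    · have : B v = ∅ := Set.eq_empty_of_forall_notMem fun G hG => hvW hG.1
      rw [this, measureReal_empty]
      positivity
    have hvS : v ∉ S := Finset.disjoint_right.1 hSW hvW
    refine le_trans ?_ hexp
    by_cases hvi : c v = i
    · refine le_trans (measureReal_mono ?_) (sbm_nbr_tail c hq.le hqp.le (by linarith) hvS hx1
        (l := -1) (by simp) (4 * L))
      rintro G ⟨-, hG⟩
      simp only [hvi, iff_true, not_le] at hG
      have := mul_le_mul_of_nonneg_left hi hpq.le
      simp only [Set.mem_ofPred_eq, hvi]
      linarith
    · refine le_trans (measureReal_mono ?_) (sbm_nbr_tail c hq.le hqp.le (by linarith) hvS hx1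
        (l := 1) (by simp) (4 * L))
      rintro G ⟨-, hG⟩
      simp only [hvi, iff_false, not_not] at hG
      have := mul_le_mul_of_nonneg_left (hj _ hvi) hpq.le
      simp only [Set.mem_ofPred_eq]
      linarith
  have hunion : μ.real (⋃ v, B v) ≤ 3 / (n : ℝ) ^ 3 := by
    calc μ.real (⋃ v, B v) ≤ ∑ v, μ.real (B v) := measureReal_iUnion_fintype_le B
      _ ≤ ∑ _v : Fin n, 3 / (n : ℝ) ^ 4 := Finset.sum_le_sum fun v _ => hB v
      _ = 3 / (n : ℝ) ^ 3 := by
        simp only [Finset.sum_const, Finset.card_univ, Fintype.card_fin, nsmul_eq_mul]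
        field_simp
  have hcompl : μ.real (⋃ v, B v)ᶜ = 1 - μ.real (⋃ v, B v) :=
    probReal_compl_eq_one_sub (Set.toFinite _).measurableSet
  calc ENNReal.ofReal (1 - 3 / (n : ℝ) ^ 3) ≤ ENNReal.ofReal (μ.real (⋃ v, B v)ᶜ) :=
        ENNReal.ofReal_le_ofReal (by linarith)
    _ = μ (⋃ v, B v)ᶜ := ofReal_measureReal
    _ ≤ _ := measure_mono fun G hG => Set.ext fun v => by
        have hv : ¬G ∈ B v := fun h => hG (Set.mem_iUnion.2 ⟨v, h⟩)
        simp only [B, Set.mem_ofPred_eq, not_and, not_not] at hv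
        simp only [Set.mem_ofPred_eq, clusterF, Finset.mem_filter, Finset.mem_univ, true_and]
        rw [and_comm (a := c v = i)]
        exact and_congr_right hv
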